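/- Let k, t, p, q be integers with k ≥ 2t, t ≥ 1, 1 ≤ p ≤ 2t − 1, q > 0 and q ≥ p − 1. If C_{p,q} is a submatrix of A_{k,t}, then q ≤ k − 2t + 1. -/

import Mathlib

/-- The `n × n` circulant 0,1-matrix (as a `Bool`-matrix) whose entry in row `i`,
column `j` is `1` iff `(i - j) mod n < p`.  `Cmat (p+q) p` is the matrix `C_{p,q}`. -/
def Cmat (n p : ℕ) : Matrix (Fin n) (Fin n) Bool :=
  fun i j => decide ((i.val + n - j.val) % n < p)

/-- A 0,1-matrix `C` of size `n × m` is a submatrix of `A_{k,t}`: there are pairwise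
distinct `t`-element subsets `A i` of `[k]` indexing the rows and pairwise distinct
`t`-element subsets `B j` of `[k]` indexing the columns such that `C i j = 1` iff
`A i ∩ B j ≠ ∅`. -/
def IsSubmatrixOfA (k t : ℕ) {n m : ℕ} (C : Matrix (Fin n) (Fin m) Bool) : Prop :=
  ∃ (A : Fin n → Finset (Fin k)) (B : Fin m → Finset (Fin k)),
    Function.Injective A ∧ Function.Injective B ∧
    (∀ i, (A i).card = t) ∧ (∀ j, (B j).card = t) ∧
    (∀ i j, C i j = true ↔ (A i ∩ B j).Nonempty)

/-- Boolean product of 0,1-matrices: `(X·Y)[i][j] = 1` iff there is `l` with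
`X[i][l] = 1` and `Y[l][j] = 1`. -/
def boolMul {n r m : ℕ} (X : Matrix (Fin n) (Fin r) Bool)
    (Y : Matrix (Fin r) (Fin m) Bool) : Matrix (Fin n) (Fin m) Bool :=
  fun i j => decide (∃ l, X i l = true ∧ Y l j = true)

/-- The number of ones in a 0,1-vector. -/
def wt {n : ℕ} (v : Fin n → Bool) : ℕ := (Finset.univ.filter fun a => v a = true).card

/-- A square 0,1-matrix is an isolation matrix: there is a permutation `σ` with
`B[i][σ i] = 1` for all `i`, and no two of these ones lie in a `2 × 2` all-one
submatrix. -/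
def IsIsolation {s : ℕ} (B : Matrix (Fin s) (Fin s) Bool) : Prop :=
  ∃ σ : Equiv.Perm (Fin s), (∀ i, B i (σ i) = true) ∧
    ∀ i j, i ≠ j → ¬(B i (σ j) = true ∧ B j (σ i) = true)

/-- Explicit value of the cyclic difference of two residues modulo `n`. -/
lemma cyclic_sub_eq {n r i : ℕ} (hr : r < n) (hi : i < n) :
    (r + n - i) % n = if i ≤ r then r - i else r + n - i := by
  split_ifs with h
  · rw [show r + n - i = (r - i) + n by omega, Nat.add_mod_right, Nat.mod_eq_of_lt (by omega)]
  · exact Nat.mod_eq_of_lt (by omega)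

lemma Cmat_eq_true_iff {n p : ℕ} (i j : Fin n) :
    Cmat n p i j = true ↔ (if j.val ≤ i.val then i.val - j.val else i.val + n - j.val) < p := by
  rw [Cmat, decide_eq_true_iff, cyclic_sub_eq i.2 j.2]

/-- An all-one submatrix of `C_{p,q}` with `q > 0` has at most `p + q` rows and columns. -/
lemma card_add_card_le_of_Cmat {n p : ℕ} (hpn : p < n) (R C : Finset (Fin n))
    (h : ∀ r ∈ R, ∀ c ∈ C, Cmat n p r c = true) : R.card + C.card ≤ n := by
  have hn : 0 < n := by omega
  let g : Fin n → Fin n := fun c =>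
    ⟨if c.val + p < n then c.val + p else c.val + p - n, by split_ifs <;> omega⟩
  have hg : Function.Injective g := by
    intro a b hab
    have := congrArg Fin.val hab
    simp only [g] at this
    ext
    split_ifs at this <;> omega
  have hdisj : Disjoint R (C.image g) := by
    rw [Finset.disjoint_left]
    intro r hr hrg
    obtain ⟨c, hc, rfl⟩ := Finset.mem_image.1 hrg
    have := (Cmat_eq_true_iff _ _).1 (h _ hr c hc)
    simp only [g] at this
    split_ifs at this <;> omega
  rw [← Finset.card_image_of_injective C hg, ← Finset.card_union_of_disjoint hdisj]
  simpa using Finset.card_le_univ (R ∪ C.image g)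

/-- If `n ≥ 2p - 1`, an all-one submatrix through a diagonal entry of the circulant has
at most `p + 1` rows and columns. -/
lemma card_add_card_le_of_Cmat_of_mem {n p : ℕ} (hpn : 2 * p ≤ n + 1) (R C : Finset (Fin n))
    (h : ∀ r ∈ R, ∀ c ∈ C, Cmat n p r c = true) (i : Fin n) (hiR : i ∈ R) (hiC : i ∈ C) :
    R.card + C.card ≤ p + 1 := by
  let a : Fin n → ℕ := fun r => if i.val ≤ r.val then r.val - i.val else r.val + n - i.val
  let b : Fin n → ℕ := fun c => if c.val ≤ i.val then i.val - c.val else i.val + n - c.val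
  have ha : Function.Injective a := by
    intro x y hxy
    simp only [a] at hxy
    ext
    split_ifs at hxy <;> omega
  have hb : Function.Injective b := by
    intro x y hxy
    simp only [b] at hxy
    ext
    split_ifs at hxy <;> omega
  have hab : ∀ r ∈ R, ∀ c ∈ C, a r + b c < p := by
    intro r hr c hc
    have h1 := (Cmat_eq_true_iff _ _).1 (h r hr c hc)
    have h2 := (Cmat_eq_true_iff _ _).1 (h r hr i hiC)
    have h3 := (Cmat_eq_true_iff _ _).1 (h i hiR c hc)
    simp only [a, b]
    split_ifs at * <;> omega
  obtain ⟨m, hmR, hm⟩ := Finset.exists_max_image R a ⟨i, hiR⟩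
  have hR : R.card ≤ (Finset.range (a m + 1)).card :=
    Finset.card_le_card_of_injOn a
      (fun r hr => Finset.mem_coe.2 (Finset.mem_range.2 (Nat.lt_succ_of_le (hm r hr)))) ha.injOn
  have hC : C.card ≤ (Finset.range (p - a m)).card :=
    Finset.card_le_card_of_injOn b
      (fun c hc => Finset.mem_coe.2 (Finset.mem_range.2 (by have := hab m hmR c hc; omega)))
      hb.injOn
  have := hab m hmR i hiC
  simp only [Finset.card_range] at hR hC
  omega

lemma sum_card_fibers {n k t : ℕ} (A : Fin n → Finset (Fin k)) (hA : ∀ i, (A i).card = t) :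
    ∑ x, (Finset.univ.filter fun i => x ∈ A i).card = n * t := by
  have := Finset.sum_card_bipartiteAbove_eq_sum_card_bipartiteBelow
    (s := (Finset.univ : Finset (Fin n))) (t := (Finset.univ : Finset (Fin k)))
    (fun i x => x ∈ A i)
  simp only [Finset.bipartiteAbove, Finset.bipartiteBelow] at this
  rw [← this]
  simp [hA]

/-- for `k ≥ 2t`, `t ≥ 1`, `1 ≤ p ≤ 2t - 1`, `q > 0` and `q ≥ p - 1`,
if `C_{p,q}` is a submatrix of `A_{k,t}` then `q ≤ k - 2t + 1`. -/
theorem stmt_9 (k t p q : ℕ) (ht : 1 ≤ t) (hk : 2 * t ≤ k)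
    (hp1 : 1 ≤ p) (hp2 : p ≤ 2 * t - 1) (hq : 0 < q) (hqp : p - 1 ≤ q)
    (h : IsSubmatrixOfA k t (Cmat (p + q) p)) :
    q ≤ k - 2 * t + 1 := by
  obtain ⟨A, B, -, -, hA, hB, hAB⟩ := h
  let R : Fin k → Finset (Fin (p + q)) := fun x => Finset.univ.filter fun i => x ∈ A i
  let C : Fin k → Finset (Fin (p + q)) := fun x => Finset.univ.filter fun j => x ∈ B j
  have hones : ∀ x, ∀ r ∈ R x, ∀ c ∈ C x, Cmat (p + q) p r c = true := by
    intro x r hr c hc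
    simp only [R, C, Finset.mem_filter, Finset.mem_univ, true_and] at hr hc
    exact (hAB r c).2 ⟨x, Finset.mem_inter.2 ⟨hr, hc⟩⟩
  have hdiag : ∀ i, (A i ∩ B i).Nonempty := fun i =>
    (hAB i i).1 ((Cmat_eq_true_iff i i).2 (by simp; omega))
  choose f hf using hdiag
  have hfR : ∀ i, i ∈ R (f i) := fun i => by
    simpa [R] using (Finset.mem_inter.1 (hf i)).1
  have hfC : ∀ i, i ∈ C (f i) := fun i => by
    simpa [C] using (Finset.mem_inter.1 (hf i)).2
  have hinj : Function.Injective f := by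
    intro i j hij
    have h1 := (Cmat_eq_true_iff _ _).1 (hones _ i (hfR i) j (hij ▸ hfC j))
    have h2 := (Cmat_eq_true_iff _ _).1 (hones _ j (hij ▸ hfR j) i (hfC i))
    ext
    split_ifs at * <;> omega
  let S := Finset.univ.image f
  have hS : S.card = p + q := by simp [S, Finset.card_image_of_injective _ hinj]
  have hSc : Sᶜ.card + (p + q) = k := by
    rw [← hS, add_comm, Finset.card_add_card_compl, Fintype.card_fin]
  have hsum : ∑ x, ((R x).card + (C x).card) = (p + q) * t + (p + q) * t := by
    rw [Finset.sum_add_distrib, sum_card_fibers A hA, sum_card_fibers B hB]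
  have hsumS : ∑ x ∈ S, ((R x).card + (C x).card) ≤ S.card * (p + 1) := by
    refine Finset.sum_le_card_nsmul S _ _ fun x hx => ?_
    obtain ⟨i, -, rfl⟩ := Finset.mem_image.1 hx
    exact card_add_card_le_of_Cmat_of_mem (by omega) _ _ (hones _) i (hfR i) (hfC i)
  have hsumSc : ∑ x ∈ Sᶜ, ((R x).card + (C x).card) ≤ Sᶜ.card * (p + q) :=
    Finset.sum_le_card_nsmul Sᶜ _ _ fun x _ =>
      card_add_card_le_of_Cmat (by omega) _ _ (hones x)
  rw [← Finset.sum_add_sum_compl S] at hsum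
  rw [hS] at hsumS
  have hle : (p + q) * (2 * t) ≤ (p + q) * (p + 1 + Sᶜ.card) := by nlinarith
  have := Nat.le_of_mul_le_mul_left hle (by omega)
  omega
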